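/- arXiv:2211.02330 — 2 statements merged into one kernel-verified Lean document; each statement's English description precedes it below -/
import Mathlib

section
/- Every run admitted by the single-execution model is also legal under the function-reuse model: every state reachable from the initial state in the single-execution model is also reachable from the initial state in the function-reuse model. Specifically, every single-execution transition other than respond is also a function-reuse transition, and a single-execution respond transition from (M, e, Pr) to (M, done, Pr) is simulated in the function-reuse model by a respond transition to (M, free, Pr) followed by an ε (Invalidate Env) transition to (M, done, Pr). -/
/-- The event component of a serverless-function state: either an event id,
    `free`, or `done`. -/
inductive EvComp (EventId : Type) : Type where
  | ev : EventId → EvComp EventId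
  | free : EvComp EventId
  | done : EvComp EventId

/-- A serverless-function state `σ = (M, E, Pr)`. -/
structure FnState (Var Val EventId Promise : Type) [DecidableEq Promise] : Type where
  M : Var → Val
  E : EvComp EventId
  Pr : Finset Promise

/-- Transition labels; `eps` (Invalidate Env) is only used by the function-reuse
    model. -/
inductive Lbl (Var Val Promise : Type) : Type where
  | receive : Val → Lbl Var Val Promise
  | respond : Val → Lbl Var Val Promise
  | exec : ((Var → Val) → (Var → Val)) → Lbl Var Val Promise
  | startAsync : Promise → Lbl Var Val Promise
  | resolve : Promise → Lbl Var Val Promise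
  | eps : Lbl Var Val Promise

/-- Small-step transitions of the single-execution model (no `eps` step; `respond`
    yields a `done` state). -/
inductive SStep {Var Val EventId Promise : Type} [DecidableEq Var] [DecidableEq Promise]
    (input response : Var) :
    FnState Var Val EventId Promise → Lbl Var Val Promise →
    FnState Var Val EventId Promise → Prop where
  | receive (M : Var → Val) (Pr : Finset Promise) (v : Val) (e : EventId) :
      SStep input response ⟨M, .free, Pr⟩ (.receive v)
        ⟨Function.update M input v, .ev e, Pr⟩
  | respond (M : Var → Val) (Pr : Finset Promise) (e : EventId) (v : Val)
      (h : M response = v) :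
      SStep input response ⟨M, .ev e, Pr⟩ (.respond v) ⟨M, .done, Pr⟩
  | exec (M : Var → Val) (Pr : Finset Promise) (e : EventId)
      (C : (Var → Val) → (Var → Val)) :
      SStep input response ⟨M, .ev e, Pr⟩ (.exec C) ⟨C M, .ev e, Pr⟩
  | startAsync (M : Var → Val) (E : EvComp EventId) (Pr : Finset Promise) (p : Promise)
      (h : p ∉ Pr) :
      SStep input response ⟨M, E, Pr⟩ (.startAsync p) ⟨M, E, insert p Pr⟩
  | resolve (M : Var → Val) (E : EvComp EventId) (Pr : Finset Promise) (p : Promise)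
      (h : p ∈ Pr) :
      SStep input response ⟨M, E, Pr⟩ (.resolve p) ⟨M, E, Pr.erase p⟩

/-- Small-step transitions of the function-reuse model: identical to the
    single-execution model except that `respond` yields a `free` state, and an
    additional `eps` (Invalidate Env) transition maps a `free` state to a `done`
    state. -/
inductive RStep {Var Val EventId Promise : Type} [DecidableEq Var] [DecidableEq Promise]
    (input response : Var) :
    FnState Var Val EventId Promise → Lbl Var Val Promise →
    FnState Var Val EventId Promise → Prop where
  | receive (M : Var → Val) (Pr : Finset Promise) (v : Val) (e : EventId) :
      RStep input response ⟨M, .free, Pr⟩ (.receive v)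
        ⟨Function.update M input v, .ev e, Pr⟩
  | respond (M : Var → Val) (Pr : Finset Promise) (e : EventId) (v : Val)
      (h : M response = v) :
      RStep input response ⟨M, .ev e, Pr⟩ (.respond v) ⟨M, .free, Pr⟩
  | invalidate (M : Var → Val) (Pr : Finset Promise) :
      RStep input response ⟨M, .free, Pr⟩ .eps ⟨M, .done, Pr⟩
  | exec (M : Var → Val) (Pr : Finset Promise) (e : EventId)
      (C : (Var → Val) → (Var → Val)) :
      RStep input response ⟨M, .ev e, Pr⟩ (.exec C) ⟨C M, .ev e, Pr⟩
  | startAsync (M : Var → Val) (E : EvComp EventId) (Pr : Finset Promise) (p : Promise)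
      (h : p ∉ Pr) :
      RStep input response ⟨M, E, Pr⟩ (.startAsync p) ⟨M, E, insert p Pr⟩
  | resolve (M : Var → Val) (E : EvComp EventId) (Pr : Finset Promise) (p : Promise)
      (h : p ∈ Pr) :
      RStep input response ⟨M, E, Pr⟩ (.resolve p) ⟨M, E, Pr.erase p⟩

/-- Reachability by some sequence of single-execution transitions. -/
def SReaches {Var Val EventId Promise : Type} [DecidableEq Var] [DecidableEq Promise]
    (input response : Var) :
    FnState Var Val EventId Promise → FnState Var Val EventId Promise → Prop :=
  Relation.ReflTransGen (fun σ σ' => ∃ ℓ, SStep input response σ ℓ σ')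

/-- Reachability by some sequence of function-reuse transitions. -/
def RReaches {Var Val EventId Promise : Type} [DecidableEq Var] [DecidableEq Promise]
    (input response : Var) :
    FnState Var Val EventId Promise → FnState Var Val EventId Promise → Prop :=
  Relation.ReflTransGen (fun σ σ' => ∃ ℓ, RStep input response σ ℓ σ')

/-- Every single-execution transition other than `respond` is a function-reuse transition. -/
theorem SStep.toRStep {Var Val EventId Promise : Type} [DecidableEq Var] [DecidableEq Promise]
    {input response : Var} {σ σ' : FnState Var Val EventId Promise} {ℓ : Lbl Var Val Promise}
    (hℓ : ∀ v : Val, ℓ ≠ .respond v) (h : SStep input response σ ℓ σ') :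
    RStep input response σ ℓ σ' := by
  cases h with
  | receive M Pr v e => exact .receive M Pr v e
  | respond M Pr e v h => exact absurd rfl (hℓ v)
  | exec M Pr e C => exact .exec M Pr e C
  | startAsync M E Pr p h => exact .startAsync M E Pr p h
  | resolve M E Pr p h => exact .resolve M E Pr p h

/-- A single-execution `respond` is a function-reuse `respond` followed by `eps`. -/
theorem SStep.respond_simulation {Var Val EventId Promise : Type} [DecidableEq Var]
    [DecidableEq Promise] {input response : Var} {σ σ' : FnState Var Val EventId Promise}
    {v : Val} (h : SStep input response σ (.respond v) σ') :
    RStep input response σ (.respond v) ⟨σ.M, .free, σ.Pr⟩ ∧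
      RStep input response ⟨σ.M, .free, σ.Pr⟩ .eps σ' := by
  cases h with
  | respond M Pr e v h => exact ⟨.respond M Pr e v h, .invalidate M Pr⟩

/-- Each single-execution transition is simulated by a function-reuse run. -/
theorem SStep.rReaches {Var Val EventId Promise : Type} [DecidableEq Var]
    [DecidableEq Promise] {input response : Var} {σ σ' : FnState Var Val EventId Promise}
    {ℓ : Lbl Var Val Promise} (h : SStep input response σ ℓ σ') :
    RReaches input response σ σ' := by
  by_cases hℓ : ∀ v : Val, ℓ ≠ .respond v
  · exact .single ⟨ℓ, h.toRStep hℓ⟩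
  · push Not at hℓ
    obtain ⟨v, rfl⟩ := hℓ
    obtain ⟨h₁, h₂⟩ := h.respond_simulation
    exact .tail (.single ⟨_, h₁⟩) ⟨_, h₂⟩

/-- Reachability in the single-execution model implies it in the function-reuse model. -/
theorem SReaches.rReaches {Var Val EventId Promise : Type} [DecidableEq Var]
    [DecidableEq Promise] {input response : Var} {σ σ' : FnState Var Val EventId Promise}
    (h : SReaches input response σ σ') : RReaches input response σ σ' := by
  induction h with
  | refl => exact .refl
  | tail _ hstep ih =>
    obtain ⟨_, hstep⟩ := hstep
    exact Relation.ReflTransGen.trans ih hstep.rReaches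

/-- Every run admitted by the single-execution model is also legal under the
function-reuse model: every state reachable from the initial state in the
single-execution model is reachable from the initial state in the function-reuse model.
Specifically, every single-execution transition other than `respond` is also a
function-reuse transition, and a single-execution `respond` transition from
`(M, e, Pr)` to `(M, done, Pr)` is simulated in the function-reuse model by a `respond`
transition to `(M, free, Pr)` followed by an `eps` (Invalidate Env) transition to
`(M, done, Pr)`. -/
theorem single_runs_legal_in_reuse
    {Var Val EventId Promise : Type} [DecidableEq Var] [DecidableEq Promise]
    (input response : Var) (M₀ : Var → Val) :
    (∀ σ : FnState Var Val EventId Promise,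
        SReaches input response ⟨M₀, .free, (∅ : Finset Promise)⟩ σ →
        RReaches input response ⟨M₀, .free, (∅ : Finset Promise)⟩ σ) ∧
    (∀ (σ σ' : FnState Var Val EventId Promise) (ℓ : Lbl Var Val Promise),
        (∀ v : Val, ℓ ≠ .respond v) →
        SStep input response σ ℓ σ' → RStep input response σ ℓ σ') ∧
    (∀ (σ σ' : FnState Var Val EventId Promise) (v : Val),
        SStep input response σ (.respond v) σ' →
        RStep input response σ (.respond v) ⟨σ.M, .free, σ.Pr⟩ ∧
        RStep input response ⟨σ.M, .free, σ.Pr⟩ .eps σ') := by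
  exact ⟨fun _ h => h.rReaches, fun _ _ _ hℓ h => h.toRStep hℓ,
    fun _ _ _ h => h.respond_simulation⟩
end

section
/- The function-reuse model admits runs that are not possible under the single-execution model: there exists an execution of the function-reuse model from the initial state containing two receive (Start Event) transitions, whereas no execution of the single-execution model from the initial state contains more than one receive transition. -/
/-- A finite execution of length `n` of the single-execution model from the initial
    state. -/
def SExec {Var Val EventId Promise : Type} [DecidableEq Var] [DecidableEq Promise]
    (input response : Var) (M₀ : Var → Val) (n : ℕ)
    (states : ℕ → FnState Var Val EventId Promise)
    (labels : ℕ → Lbl Var Val Promise) : Prop :=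
  states 0 = ⟨M₀, .free, (∅ : Finset Promise)⟩ ∧
  ∀ i < n, SStep input response (states i) (labels i) (states (i + 1))

/-- A finite execution of length `n` of the function-reuse model from the initial
    state. -/
def RExec {Var Val EventId Promise : Type} [DecidableEq Var] [DecidableEq Promise]
    (input response : Var) (M₀ : Var → Val) (n : ℕ)
    (states : ℕ → FnState Var Val EventId Promise)
    (labels : ℕ → Lbl Var Val Promise) : Prop :=
  states 0 = ⟨M₀, .free, (∅ : Finset Promise)⟩ ∧
  ∀ i < n, RStep input response (states i) (labels i) (states (i + 1))

/-- A `receive` step of the single-execution model starts in a `free` state and ends in a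
non-`free` one. -/
theorem SStep.free_of_receive {Var Val EventId Promise : Type} [DecidableEq Var]
    [DecidableEq Promise] {input response : Var} {s t : FnState Var Val EventId Promise} {v : Val}
    (h : SStep input response s (.receive v) t) : s.E = .free ∧ t.E ≠ .free := by
  cases h
  simp

/-- A non-`free` state of the single-execution model never becomes `free` again. -/
theorem SStep.ne_free {Var Val EventId Promise : Type} [DecidableEq Var]
    [DecidableEq Promise] {input response : Var} {s t : FnState Var Val EventId Promise}
    {l : Lbl Var Val Promise} (h : SStep input response s l t) (hs : s.E ≠ .free) :
    t.E ≠ .free := by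
  cases h <;> simp_all

/-- In a single-execution run, no `receive` step follows an earlier one. -/
theorem SExec.not_receive_of_lt {Var Val EventId Promise : Type} [DecidableEq Var]
    [DecidableEq Promise] {input response : Var} {M₀ : Var → Val} {n : ℕ}
    {states : ℕ → FnState Var Val EventId Promise} {labels : ℕ → Lbl Var Val Promise}
    (h : SExec input response M₀ n states labels) {i j : ℕ} (hij : i < j) (hj : j < n)
    {v v' : Val} (hi : labels i = .receive v) : labels j ≠ .receive v' := by
  intro hlj
  have key : ∀ k, i + 1 ≤ k → k ≤ j → (states k).E ≠ .free := by
    intro k hk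
    induction k, hk using Nat.le_induction with
    | base =>
      intro _
      have step := h.2 i (by omega)
      rw [hi] at step
      exact step.free_of_receive.2
    | succ k _ ih => exact fun hkj => (h.2 k (by omega)).ne_free (ih (by omega))
  have step := h.2 j hj
  rw [hlj] at step
  exact key j hij le_rfl step.free_of_receive.1

/-- The function-reuse model admits runs that are not possible under the
single-execution model: there exists an execution of the function-reuse model from the
initial state containing two `receive` (Start Event) transitions, whereas no execution
of the single-execution model from the initial state contains more than one `receive`
transition. -/
theorem reuse_strictly_more_runs
    {Var Val EventId Promise : Type} [DecidableEq Var] [DecidableEq Promise]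
    [Nonempty EventId]
    (input response : Var) (M₀ : Var → Val) :
    (∃ (n : ℕ) (states : ℕ → FnState Var Val EventId Promise)
        (labels : ℕ → Lbl Var Val Promise),
        RExec input response M₀ n states labels ∧
        ∃ i j, i < j ∧ j < n ∧
          (∃ v : Val, labels i = .receive v) ∧ (∃ v : Val, labels j = .receive v)) ∧
    (∀ (n : ℕ) (states : ℕ → FnState Var Val EventId Promise)
        (labels : ℕ → Lbl Var Val Promise),
        SExec input response M₀ n states labels →
        ∀ i j, i < n → j < n → ∀ v v' : Val,
          labels i = .receive v → labels j = .receive v' → i = j) := by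
  constructor
  · obtain ⟨e⟩ := ‹Nonempty EventId›
    have receive_step : RStep input response ⟨M₀, .free, (∅ : Finset Promise)⟩
        (.receive (M₀ input)) ⟨M₀, .ev e, ∅⟩ := by
      simpa using RStep.receive (input := input) (response := response) M₀
        (∅ : Finset Promise) (M₀ input) e
    refine ⟨3, fun k => if k % 2 = 0 then ⟨M₀, .free, ∅⟩ else ⟨M₀, .ev e, ∅⟩,
      fun k => if k % 2 = 0 then .receive (M₀ input) else .respond (M₀ response),
      ⟨rfl, fun i hi => ?_⟩, 0, 2, by omega, by omega, ⟨_, rfl⟩, ⟨_, rfl⟩⟩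
    interval_cases i
    · exact receive_step
    · exact RStep.respond M₀ ∅ e _ rfl
    · exact receive_step
  · intro n states labels h i j hi hj v v' hli hlj
    rcases lt_trichotomy i j with hij | hij | hij
    · exact absurd hlj (h.not_receive_of_lt hij hj hli)
    · exact hij
    · exact absurd hli (h.not_receive_of_lt hij hi hlj)
end
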